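/- arXiv:1803.06627 — 2 statements merged into one kernel-verified Lean document; each statement's English description precedes it below -/
import Mathlib

section
/- Let Q = (I,H) be a finite quiver with integers m_h, m_{h*} for each h ∈ H. The direct sum SH = ⊕_{v,w ∈ ℕ^I} SH_{v,w}, where SH_{v,w} = ℂ[t₁,t₂] ⊗ ℂ[λ^i_s : i∈I, 1≤s≤v^i]^{S_v} ⊗ ℂ[z^j_t : j∈I, 1≤t≤w^j]^{S_w}, equipped with the shuffle product (f,g) ↦ Σ_{σ ∈ ∏_i Sh(v₁^i,v₂^i) × ∏_j Sh(w₁^j,w₂^j)} σ(f·g·fac_{v₁+v₂,w₁+w₂}) with fac_{v₁+v₂,w₁+w₂} = fac₁·fac₂ as specified below, is an associative unital ℕ^I × ℕ^I-graded ℂ[t₁,t₂]-algebra, with unit 1 ∈ SH_{0,0}. -/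
open scoped Classical
open MvPolynomial

noncomputable section

/-- An `(n,m)`-shuffle: a permutation of `{1,…,n+m}` strictly increasing on the
first block `{1,…,n}` and on the second block `{n+1,…,n+m}`. -/
def IsShuffle (n m : ℕ) (τ : Equiv.Perm (Fin (n + m))) : Prop :=
  StrictMono (fun i : Fin n => τ (Fin.castAdd m i)) ∧
  StrictMono (fun j : Fin m => τ (Fin.natAdd n j))

/-- The set of variables `t₁, t₂`, `λ^i_s` (`i ∈ I`, `1 ≤ s ≤ v(i)`) and
`z^j_t` (`j ∈ I`, `1 ≤ t ≤ w(j)`). -/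
abbrev QVar (I : Type) (v w : I → ℕ) : Type :=
  Fin 2 ⊕ ((Σ i : I, Fin (v i)) ⊕ (Σ j : I, Fin (w j)))

variable {I : Type}

def t1Var {v w : I → ℕ} : QVar I v w := Sum.inl 0
def t2Var {v w : I → ℕ} : QVar I v w := Sum.inl 1
def lamVar {v w : I → ℕ} (i : I) (s : Fin (v i)) : QVar I v w := Sum.inr (Sum.inl ⟨i, s⟩)
def zVar {v w : I → ℕ} (j : I) (t : Fin (w j)) : QVar I v w := Sum.inr (Sum.inr ⟨j, t⟩)

/-- Relabel the `λ`- and `z`-variables colorwise, leaving `t₁, t₂` fixed. -/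
def renameColors {v w v' w' : I → ℕ}
    (fl : ∀ i, Fin (v i) → Fin (v' i)) (fz : ∀ j, Fin (w j) → Fin (w' j)) :
    QVar I v w → QVar I v' w'
  | Sum.inl t => Sum.inl t
  | Sum.inr (Sum.inl ⟨i, s⟩) => Sum.inr (Sum.inl ⟨i, fl i s⟩)
  | Sum.inr (Sum.inr ⟨j, t⟩) => Sum.inr (Sum.inr ⟨j, fz j t⟩)

/-- A polynomial is symmetric in the `λ`-variables of each color and in the
`z`-variables of each color. -/
def IsSym (v w : I → ℕ) (p : MvPolynomial (QVar I v w) ℂ) : Prop :=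
  ∀ (ρ : ∀ i, Equiv.Perm (Fin (v i))) (π : ∀ j, Equiv.Perm (Fin (w j))),
    rename (renameColors (fun i s => ρ i s) (fun j t => π j t)) p = p

/-- The canonical map into the fraction field. -/
def embQ (v w : I → ℕ) :
    MvPolynomial (QVar I v w) ℂ →+* FractionRing (MvPolynomial (QVar I v w) ℂ) :=
  algebraMap _ _

/-- A tuple of shuffles, one for each `λ`-color and one for each `z`-color. -/
abbrev ShufflePair (v₁ v₂ w₁ w₂ : I → ℕ) : Type :=
  ((i : I) → Equiv.Perm (Fin (v₁ i + v₂ i))) × ((j : I) → Equiv.Perm (Fin (w₁ j + w₂ j)))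

def IsShufflePair {v₁ v₂ w₁ w₂ : I → ℕ} (σ : ShufflePair v₁ v₂ w₁ w₂) : Prop :=
  (∀ i, IsShuffle (v₁ i) (v₂ i) (σ.1 i)) ∧ ∀ j, IsShuffle (w₁ j) (w₂ j) (σ.2 j)

/-- Position of the `s`-th primed `λ`-variable of color `i` under the shuffle `σ`. -/
def lamP {v₁ v₂ w₁ w₂ : I → ℕ} (σ : ShufflePair v₁ v₂ w₁ w₂) (i : I) (s : Fin (v₁ i)) :
    Fin ((fun i => v₁ i + v₂ i) i) := σ.1 i (Fin.castAdd (v₂ i) s)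

/-- Position of the `t`-th double-primed `λ`-variable of color `i` under the shuffle `σ`. -/
def lamPP {v₁ v₂ w₁ w₂ : I → ℕ} (σ : ShufflePair v₁ v₂ w₁ w₂) (i : I) (t : Fin (v₂ i)) :
    Fin ((fun i => v₁ i + v₂ i) i) := σ.1 i (Fin.natAdd (v₁ i) t)

/-- Position of the `s`-th primed `z`-variable of color `j` under the shuffle `σ`. -/
def zP {v₁ v₂ w₁ w₂ : I → ℕ} (σ : ShufflePair v₁ v₂ w₁ w₂) (j : I) (s : Fin (w₁ j)) :
    Fin ((fun j => w₁ j + w₂ j) j) := σ.2 j (Fin.castAdd (w₂ j) s)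

/-- Position of the `t`-th double-primed `z`-variable of color `j` under the shuffle `σ`. -/
def zPP {v₁ v₂ w₁ w₂ : I → ℕ} (σ : ShufflePair v₁ v₂ w₁ w₂) (j : I) (t : Fin (w₂ j)) :
    Fin ((fun j => w₁ j + w₂ j) j) := σ.2 j (Fin.natAdd (w₁ j) t)

/-- The factor `fac = fac₁ ⋅ fac₂` of the framed shuffle algebra of the quiver
with arrow set `H`, sources `hout`, targets `hinc` and weights `mh, mhs`, in the
variable positions determined by the shuffle `σ`. -/
def facQ {H : Type} [Fintype I] [Fintype H]
    (hout hinc : H → I) (mh mhs : H → ℤ) {v₁ v₂ w₁ w₂ : I → ℕ}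
    (σ : ShufflePair v₁ v₂ w₁ w₂) :
    FractionRing (MvPolynomial (QVar I (fun i => v₁ i + v₂ i) (fun j => w₁ j + w₂ j)) ℂ) :=
  let e := embQ (I := I) (fun i => v₁ i + v₂ i) (fun j => w₁ j + w₂ j)
  -- fac₁
  (∏ i : I, ∏ s : Fin (v₁ i), ∏ t : Fin (v₂ i),
    e (X (lamVar i (lamP σ i s)) - X (lamVar i (lamPP σ i t)) + X t1Var + X t2Var) /
    e (X (lamVar i (lamPP σ i t)) - X (lamVar i (lamP σ i s)))) *
  -- fac₂
  ((∏ h : H,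
      (∏ s : Fin (v₁ (hout h)), ∏ t : Fin (v₂ (hinc h)),
        e (X (lamVar (hinc h) (lamPP σ (hinc h) t)) - X (lamVar (hout h) (lamP σ (hout h) s)) +
          C (mh h : ℂ) * X t1Var)) *
      (∏ s : Fin (v₁ (hinc h)), ∏ t : Fin (v₂ (hout h)),
        e (X (lamVar (hout h) (lamPP σ (hout h) t)) - X (lamVar (hinc h) (lamP σ (hinc h) s)) +
          C (mhs h : ℂ) * X t2Var))) *
    (∏ i : I,
      (∏ s : Fin (v₁ i), ∏ t : Fin (w₂ i),
        e (X (zVar i (zPP σ i t)) - X (lamVar i (lamP σ i s)) + X t1Var)) *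
      (∏ s : Fin (w₁ i), ∏ t : Fin (v₂ i),
        e (X (lamVar i (lamPP σ i t)) - X (zVar i (zP σ i s)) + X t2Var))))

/-- The framed shuffle-product sum `Σ_σ σ(f · g · fac)` computed in the fraction field. -/
def hallSum {H : Type} [Fintype I] [DecidableEq I] [Fintype H]
    (hout hinc : H → I) (mh mhs : H → ℤ) {v₁ v₂ w₁ w₂ : I → ℕ}
    (f : MvPolynomial (QVar I v₁ w₁) ℂ) (g : MvPolynomial (QVar I v₂ w₂) ℂ) :
    FractionRing (MvPolynomial (QVar I (fun i => v₁ i + v₂ i) (fun j => w₁ j + w₂ j)) ℂ) :=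
  ∑ σ ∈ Finset.univ.filter (fun σ : ShufflePair v₁ v₂ w₁ w₂ => IsShufflePair σ),
    embQ _ _ (rename (renameColors (lamP σ) (zP σ)) f) *
    embQ _ _ (rename (renameColors (lamPP σ) (zPP σ)) g) *
    facQ hout hinc mh mhs σ

/-- The graded piece `SH_{v,w} = ℂ[t₁,t₂] ⊗ ℂ[λ^i_s]^{S_v} ⊗ ℂ[z^j_t]^{S_w}`:
polynomials in `t₁, t₂` and the colored variables, symmetric in the `λ`-variables of
each color and in the `z`-variables of each color. -/
def SHsym (I : Type) (v w : I → ℕ) : Type :=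
  {p : MvPolynomial (QVar I v w) ℂ // IsSym v w p}

section ShuffleProduct

open Equiv Finset

/-! ### Shuffles as coset representatives -/

/-- The block permutation of `Fin (n + m)` acting by `a` on the first block and by `b` on the
second one. -/
def blockPerm {n m : ℕ} (a : Perm (Fin n)) (b : Perm (Fin m)) : Perm (Fin (n + m)) :=
  finSumFinEquiv.permCongr (Equiv.sumCongr a b)

@[simp] lemma blockPerm_castAdd {n m : ℕ} (a : Perm (Fin n)) (b : Perm (Fin m)) (i : Fin n) :
    blockPerm a b (Fin.castAdd m i) = Fin.castAdd m (a i) := by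
  simp [blockPerm, Equiv.permCongr_apply]

@[simp] lemma blockPerm_natAdd {n m : ℕ} (a : Perm (Fin n)) (b : Perm (Fin m)) (j : Fin m) :
    blockPerm a b (Fin.natAdd n j) = Fin.natAdd n (b j) := by
  simp [blockPerm, Equiv.permCongr_apply]

lemma perm_ext_blocks {n m : ℕ} {σ τ : Perm (Fin (n + m))}
    (h₁ : ∀ i : Fin n, σ (Fin.castAdd m i) = τ (Fin.castAdd m i))
    (h₂ : ∀ j : Fin m, σ (Fin.natAdd n j) = τ (Fin.natAdd n j)) : σ = τ := by
  ext x : 1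
  induction x using Fin.addCases with
  | left i => exact h₁ i
  | right j => exact h₂ j

lemma range_natAdd_eq_compl {n m : ℕ} (σ : Perm (Fin (n + m))) :
    Set.range (fun j : Fin m => σ (Fin.natAdd n j)) =
      (Set.range fun i : Fin n => σ (Fin.castAdd m i))ᶜ := by
  ext y
  obtain ⟨x, rfl⟩ := σ.surjective y
  induction x using Fin.addCases with
  | left i =>
    simp only [Set.mem_range, EmbeddingLike.apply_eq_iff_eq, Set.mem_compl_iff]
    constructor
    · rintro ⟨j, hj⟩
      have := congrArg Fin.val hj
      simp at this
      omega
    · intro h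
      exact absurd ⟨i, rfl⟩ h
  | right j =>
    simp only [Set.mem_range, EmbeddingLike.apply_eq_iff_eq, Set.mem_compl_iff]
    constructor
    · rintro - ⟨i, hi⟩
      have := congrArg Fin.val hi
      simp at this
      omega
    · intro _
      exact ⟨j, rfl⟩

lemma IsShuffle.eq_of_range {n m : ℕ} {σ τ : Perm (Fin (n + m))}
    (hσ : IsShuffle n m σ) (hτ : IsShuffle n m τ)
    (h : (Set.range fun i : Fin n => σ (Fin.castAdd m i)) =
      Set.range fun i : Fin n => τ (Fin.castAdd m i)) : σ = τ := by
  have h₂ : (Set.range fun j : Fin m => σ (Fin.natAdd n j)) =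
      Set.range fun j : Fin m => τ (Fin.natAdd n j) := by
    rw [range_natAdd_eq_compl, range_natAdd_eq_compl, h]
  exact perm_ext_blocks (congrFun ((hσ.1.range_inj hτ.1).1 h))
    (congrFun ((hσ.2.range_inj hτ.2).1 h₂))

lemma isShuffle_one (n m : ℕ) : IsShuffle n m 1 :=
  ⟨Fin.strictMono_castAdd m, Fin.strictMono_natAdd n⟩

lemma exists_shuffle_mul_blockPerm {n m : ℕ} (τ : Perm (Fin (n + m))) :
    ∃ σ a b, IsShuffle n m σ ∧ σ * blockPerm a b = τ := by
  set a := Tuple.sort fun i : Fin n => τ (Fin.castAdd m i)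
  set b := Tuple.sort fun j : Fin m => τ (Fin.natAdd n j)
  refine ⟨τ * blockPerm a b, a⁻¹, b⁻¹, ⟨?_, ?_⟩, ?_⟩
  · refine Monotone.strictMono_of_injective (fun i j hij => ?_) (fun i j hij => ?_)
    · simpa using Tuple.monotone_sort (fun i : Fin n => τ (Fin.castAdd m i)) hij
    · simpa using hij
  · refine Monotone.strictMono_of_injective (fun i j hij => ?_) (fun i j hij => ?_)
    · simpa using Tuple.monotone_sort (fun j : Fin m => τ (Fin.natAdd n j)) hij
    · simpa using hij
  · exact perm_ext_blocks (by simp) (by simp)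

lemma shuffle_mul_blockPerm_inj {n m : ℕ} {σ σ' : Perm (Fin (n + m))}
    {a a' : Perm (Fin n)} {b b' : Perm (Fin m)} (hσ : IsShuffle n m σ) (hσ' : IsShuffle n m σ')
    (h : σ * blockPerm a b = σ' * blockPerm a' b') : σ = σ' ∧ a = a' ∧ b = b' := by
  have hr (ρ : Perm (Fin (n + m))) (c : Perm (Fin n)) (d : Perm (Fin m)) :
      (Set.range fun i : Fin n => ρ (Fin.castAdd m i)) =
        Set.range fun i : Fin n => (ρ * blockPerm c d) (Fin.castAdd m i) := by
    simpa [Function.comp_def] using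
      (c.surjective.range_comp fun i : Fin n => ρ (Fin.castAdd m i)).symm
  obtain rfl : σ = σ' := hσ.eq_of_range hσ' (by rw [hr σ a b, h, ← hr])
  have hb := mul_left_cancel h
  refine ⟨rfl, ?_, ?_⟩
  · ext i : 1
    simpa using DFunLike.congr_fun hb (Fin.castAdd m i)
  · ext j : 1
    simpa using DFunLike.congr_fun hb (Fin.natAdd n j)

/-- Colorwise permutations of the `λ`- and `z`-variables. -/
abbrev ColorPerm (I : Type) (v w : I → ℕ) : Type :=
  ((i : I) → Perm (Fin (v i))) × ((j : I) → Perm (Fin (w j)))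

/-- The colorwise block permutation. -/
def colorBlock {v₁ v₂ w₁ w₂ : I → ℕ} (a : ColorPerm I v₁ w₁) (b : ColorPerm I v₂ w₂) :
    ShufflePair v₁ v₂ w₁ w₂ :=
  (fun i => blockPerm (a.1 i) (b.1 i), fun j => blockPerm (a.2 j) (b.2 j))

lemma isShufflePair_one {v₁ v₂ w₁ w₂ : I → ℕ} :
    IsShufflePair (1 : ShufflePair v₁ v₂ w₁ w₂) :=
  ⟨fun _ => isShuffle_one _ _, fun _ => isShuffle_one _ _⟩

lemma bijective_shuffle_mul_colorBlock (v₁ v₂ w₁ w₂ : I → ℕ) :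
    Function.Bijective (fun p : {σ : ShufflePair v₁ v₂ w₁ w₂ // IsShufflePair σ} ×
      (ColorPerm I v₁ w₁ × ColorPerm I v₂ w₂) => p.1.1 * colorBlock p.2.1 p.2.2) := by
  constructor
  · rintro ⟨⟨σ, hσ⟩, a, b⟩ ⟨⟨σ', hσ'⟩, a', b'⟩ h
    have h₁ i := shuffle_mul_blockPerm_inj (hσ.1 i) (hσ'.1 i) (congrFun (congrArg Prod.fst h) i)
    have h₂ i := shuffle_mul_blockPerm_inj (hσ.2 i) (hσ'.2 i) (congrFun (congrArg Prod.snd h) i)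
    simp only [Prod.mk.injEq, Subtype.mk.injEq]
    refine ⟨Prod.ext (funext fun i => (h₁ i).1) (funext fun i => (h₂ i).1),
      Prod.ext (funext fun i => (h₁ i).2.1) (funext fun i => (h₂ i).2.1),
      Prod.ext (funext fun i => (h₁ i).2.2) (funext fun i => (h₂ i).2.2)⟩
  · intro τ
    choose σ₁ a₁ b₁ hσ₁ h₁ using fun i => exists_shuffle_mul_blockPerm (τ.1 i)
    choose σ₂ a₂ b₂ hσ₂ h₂ using fun i => exists_shuffle_mul_blockPerm (τ.2 i)
    exact ⟨⟨⟨(σ₁, σ₂), hσ₁, hσ₂⟩, (a₁, a₂), (b₁, b₂)⟩, Prod.ext (funext h₁) (funext h₂)⟩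

lemma sum_shufflePair [Fintype I] [DecidableEq I] {v₁ v₂ w₁ w₂ : I → ℕ} {L : Type} [CommRing L]
    (φ : ShufflePair v₁ v₂ w₁ w₂ → L)
    (hφ : ∀ σ a b, φ (σ * colorBlock a b) = φ σ) :
    ∑ σ, φ σ = (Fintype.card (ColorPerm I v₁ w₁) : L) * Fintype.card (ColorPerm I v₂ w₂) *
      ∑ σ ∈ univ.filter (fun σ : ShufflePair v₁ v₂ w₁ w₂ => IsShufflePair σ), φ σ := by
  rw [← (bijective_shuffle_mul_colorBlock v₁ v₂ w₁ w₂).sum_comp φ, Fintype.sum_prod_type]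
  simp only [hφ, sum_const, card_univ, nsmul_eq_mul, Fintype.card_prod, Nat.cast_mul, ← mul_sum]
  rw [← sum_subtype_eq_sum_filter]
  simp

/-! ### The shuffle product evaluated at points of a field -/

section Values

variable {v w v₁ v₂ w₁ w₂ : I → ℕ} {H L L' : Type}
  [Field L] [Algebra ℂ L] [Field L'] [Algebra ℂ L']

/-- The action of a colorwise permutation on the variables. -/
def actVar (ρ : ColorPerm I v w) : QVar I v w → QVar I v w :=
  renameColors (fun i s => ρ.1 i s) (fun j t => ρ.2 j t)

/-- Positions of the primed variables. -/
def inclP (σ : ShufflePair v₁ v₂ w₁ w₂) :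
    QVar I v₁ w₁ → QVar I (fun i => v₁ i + v₂ i) (fun j => w₁ j + w₂ j) :=
  renameColors (lamP σ) (zP σ)

/-- Positions of the double-primed variables. -/
def inclPP (σ : ShufflePair v₁ v₂ w₁ w₂) :
    QVar I v₂ w₂ → QVar I (fun i => v₁ i + v₂ i) (fun j => w₁ j + w₂ j) :=
  renameColors (lamPP σ) (zPP σ)

lemma renameColors_injective {v' w' : I → ℕ} {fl : ∀ i, Fin (v i) → Fin (v' i)}
    {fz : ∀ j, Fin (w j) → Fin (w' j)} (hl : ∀ i, Function.Injective (fl i))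
    (hz : ∀ j, Function.Injective (fz j)) : Function.Injective (renameColors fl fz) := by
  rintro (a | ⟨i, a⟩ | ⟨i, a⟩) (b | ⟨j, b⟩ | ⟨j, b⟩) h <;>
    simp only [renameColors, Sum.inl.injEq, Sum.inr.injEq, reduceCtorEq, Sigma.mk.injEq] at h ⊢
  · exact h
  · obtain ⟨rfl, h⟩ := h
    exact ⟨rfl, heq_of_eq (hl _ (eq_of_heq h))⟩
  · obtain ⟨rfl, h⟩ := h
    exact ⟨rfl, heq_of_eq (hz _ (eq_of_heq h))⟩

lemma inclP_injective (σ : ShufflePair v₁ v₂ w₁ w₂) : Function.Injective (inclP σ) :=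
  renameColors_injective (fun i => (σ.1 i).injective.comp (Fin.castAdd_injective _ _))
    (fun j => (σ.2 j).injective.comp (Fin.castAdd_injective _ _))

lemma inclPP_injective (σ : ShufflePair v₁ v₂ w₁ w₂) : Function.Injective (inclPP σ) :=
  renameColors_injective (fun i => (σ.1 i).injective.comp (Fin.natAdd_injective _ _))
    (fun j => (σ.2 j).injective.comp (Fin.natAdd_injective _ _))

lemma actVar_injective (ρ : ColorPerm I v w) : Function.Injective (actVar ρ) :=
  renameColors_injective (fun i => (ρ.1 i).injective) (fun j => (ρ.2 j).injective)

lemma inclP_mul (ρ σ : ShufflePair v₁ v₂ w₁ w₂) :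
    inclP (ρ * σ) = actVar ρ ∘ inclP σ := by
  funext q
  rcases q with q | ⟨i, q⟩ | ⟨i, q⟩ <;> rfl

lemma inclPP_mul (ρ σ : ShufflePair v₁ v₂ w₁ w₂) :
    inclPP (ρ * σ) = actVar ρ ∘ inclPP σ := by
  funext q
  rcases q with q | ⟨i, q⟩ | ⟨i, q⟩ <;> rfl

lemma inclP_mul_colorBlock (σ : ShufflePair v₁ v₂ w₁ w₂) (a : ColorPerm I v₁ w₁)
    (b : ColorPerm I v₂ w₂) : inclP (σ * colorBlock a b) = inclP σ ∘ actVar a := by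
  funext q
  rcases q with q | ⟨i, q⟩ | ⟨i, q⟩ <;>
    simp [inclP, actVar, renameColors, lamP, zP, colorBlock]

lemma inclPP_mul_colorBlock (σ : ShufflePair v₁ v₂ w₁ w₂) (a : ColorPerm I v₁ w₁)
    (b : ColorPerm I v₂ w₂) : inclPP (σ * colorBlock a b) = inclPP σ ∘ actVar b := by
  funext q
  rcases q with q | ⟨i, q⟩ | ⟨i, q⟩ <;>
    simp [inclPP, actVar, renameColors, lamPP, zPP, colorBlock]

lemma aeval_comp_actVar {p : MvPolynomial (QVar I v w) ℂ} (hp : IsSym v w p)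
    (x : QVar I v w → L) (ρ : ColorPerm I v w) : aeval (x ∘ actVar ρ) p = aeval x p := by
  conv_rhs => rw [← hp ρ.1 ρ.2, aeval_rename]
  rfl

lemma card_cast_ne_zero (L : Type) [Field L] [Algebra ℂ L] (α : Type) [Fintype α] [Nonempty α] :
    (Fintype.card α : L) ≠ 0 := by
  have : CharZero L := charZero_of_injective_algebraMap (algebraMap ℂ L).injective
  exact_mod_cast Fintype.card_ne_zero

/-- The tautological point with coordinates the variables. -/
def genericPt (v w : I → ℕ) : QVar I v w → FractionRing (MvPolynomial (QVar I v w) ℂ) :=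
  fun q => embQ v w (X q)

lemma aeval_genericPt (p : MvPolynomial (QVar I v w) ℂ) :
    aeval (genericPt v w) p = embQ v w p :=
  (DFunLike.congr_fun (aeval_unique (IsScalarTower.toAlgHom ℂ (MvPolynomial (QVar I v w) ℂ)
    (FractionRing (MvPolynomial (QVar I v w) ℂ)))) p).symm

lemma embQ_injective (v w : I → ℕ) : Function.Injective (embQ v w) :=
  IsFractionRing.injective _ _

lemma aeval_genericPt_comp {τ : Type} (r : τ → QVar I v w) (p : MvPolynomial τ ℂ) :
    aeval (genericPt v w ∘ r) p = embQ v w (rename r p) := by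
  rw [← aeval_rename, aeval_genericPt]

lemma aeval_genericPt_comp_injective {τ : Type} {r : τ → QVar I v w}
    (hr : Function.Injective r) :
    Function.Injective (aeval (genericPt v w ∘ r) : MvPolynomial τ ℂ →ₐ[ℂ] _) := by
  intro p q h
  simp only [aeval_genericPt_comp] at h
  exact rename_injective r hr (embQ_injective v w h)

lemma exists_algHom_genericPt {x : QVar I v w → L}
    (hx : Function.Injective (aeval x : MvPolynomial _ ℂ →ₐ[ℂ] L)) :
    ∃ φ : FractionRing (MvPolynomial (QVar I v w) ℂ) →ₐ[ℂ] L,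
      (∀ q, φ (embQ v w q) = aeval x q) ∧ φ ∘ genericPt v w = x := by
  obtain ⟨φ, hφ⟩ : ∃ φ : FractionRing (MvPolynomial (QVar I v w) ℂ) →ₐ[ℂ] L,
      ∀ q, φ (embQ v w q) = aeval x q :=
    ⟨IsFractionRing.liftAlgHom hx, fun q => by simp [embQ, IsFractionRing.liftAlgHom_apply]⟩
  exact ⟨φ, hφ, funext fun q => by simp [genericPt, hφ]⟩

lemma prod_prod_perm {m n : ℕ} {M : Type} [CommMonoid M] (e : Perm (Fin m)) (e' : Perm (Fin n)) 
    (G : Fin m → Fin n → M) :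
    ∏ s, ∏ u, G (e s) (e' u) = ∏ s, ∏ u, G s u := by
  rw [Equiv.prod_comp e fun s => ∏ u, G s (e' u)]
  exact prod_congr rfl fun s _ => Equiv.prod_comp e' (G s)

lemma prod_eq_prod_castAdd_mul_prod_natAdd {m n : ℕ} {M : Type} [CommMonoid M]
    (e : Perm (Fin (m + n))) (F : Fin (m + n) → M) :
    ∏ s, F s = (∏ s, F (e (Fin.castAdd n s))) * ∏ s, F (e (Fin.natAdd m s)) := by
  rw [← Equiv.prod_comp e F, Fin.prod_univ_add]

lemma prod_lamP_mul_prod_lamPP {M : Type} [CommMonoid M]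
    (σ : ShufflePair v₁ v₂ w₁ w₂) (i : I) (F : Fin (v₁ i + v₂ i) → M) :
    ∏ s, F s = (∏ s, F (lamP σ i s)) * ∏ s, F (lamPP σ i s) :=
  prod_eq_prod_castAdd_mul_prod_natAdd (σ.1 i) F

lemma prod_zP_mul_prod_zPP {M : Type} [CommMonoid M]
    (σ : ShufflePair v₁ v₂ w₁ w₂) (i : I) (F : Fin (w₁ i + w₂ i) → M) :
    ∏ s, F s = (∏ s, F (zP σ i s)) * ∏ s, F (zPP σ i s) :=
  prod_eq_prod_castAdd_mul_prod_natAdd (σ.2 i) F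

variable [Fintype I] [Fintype H] (hout hinc : H → I) (mh mhs : H → ℤ)

/-- The factor `fac`, evaluated at a value `t` of the equivariant parameters, a point `a` for
the primed variables and a point `b` for the double-primed ones. -/
def facVal (t : Fin 2 → L) (a : QVar I v₁ w₁ → L) (b : QVar I v₂ w₂ → L) : L :=
  (∏ i : I, ∏ s : Fin (v₁ i), ∏ u : Fin (v₂ i),
    (a (lamVar i s) - b (lamVar i u) + t 0 + t 1) / (b (lamVar i u) - a (lamVar i s))) *
  ((∏ h : H,
      (∏ s : Fin (v₁ (hout h)), ∏ u : Fin (v₂ (hinc h)),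
        (b (lamVar (hinc h) u) - a (lamVar (hout h) s) + (mh h : L) * t 0)) *
      (∏ s : Fin (v₁ (hinc h)), ∏ u : Fin (v₂ (hout h)),
        (b (lamVar (hout h) u) - a (lamVar (hinc h) s) + (mhs h : L) * t 1))) *
    (∏ i : I,
      (∏ s : Fin (v₁ i), ∏ u : Fin (w₂ i), (b (zVar i u) - a (lamVar i s) + t 0)) *
      (∏ s : Fin (w₁ i), ∏ u : Fin (v₂ i), (b (lamVar i u) - a (zVar i s) + t 1))))

lemma map_facVal (φ : L →ₐ[ℂ] L') (t : Fin 2 → L) (a : QVar I v₁ w₁ → L)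
    (b : QVar I v₂ w₂ → L) :
    φ (facVal hout hinc mh mhs t a b) =
      facVal hout hinc mh mhs (φ ∘ t) (φ ∘ a) (φ ∘ b) := by
  simp only [facVal, map_mul, map_prod, map_div₀, map_add, map_sub, map_intCast,
    Function.comp_apply]

lemma facVal_comp_actVar {K : Type} [Field K] (t : Fin 2 → K)
    (a : QVar I v₁ w₁ → K) (b : QVar I v₂ w₂ → K)
    (ρ : ColorPerm I v₁ w₁) (π : ColorPerm I v₂ w₂) :
    facVal hout hinc mh mhs t (a ∘ actVar ρ) (b ∘ actVar π) =
      facVal hout hinc mh mhs t a b := by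
  unfold facVal
  refine congrArg₂ _ (prod_congr rfl fun i _ => ?_)
    (congrArg₂ _ (prod_congr rfl fun h _ => congrArg₂ _ ?_ ?_)
      (prod_congr rfl fun i _ => congrArg₂ _ ?_ ?_))
  · exact prod_prod_perm (ρ.1 i) (π.1 i) fun s u =>
      (a (lamVar i s) - b (lamVar i u) + t 0 + t 1) / (b (lamVar i u) - a (lamVar i s))
  · exact prod_prod_perm (ρ.1 _) (π.1 _) fun s u =>
      b (lamVar (hinc h) u) - a (lamVar (hout h) s) + (mh h : K) * t 0
  · exact prod_prod_perm (ρ.1 _) (π.1 _) fun s u =>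
      b (lamVar (hout h) u) - a (lamVar (hinc h) s) + (mhs h : K) * t 1
  · exact prod_prod_perm (ρ.1 _) (π.2 _) fun s u => b (zVar i u) - a (lamVar i s) + t 0
  · exact prod_prod_perm (ρ.2 _) (π.1 _) fun s u => b (lamVar i u) - a (zVar i s) + t 1

lemma facVal_split_left {K : Type} [Field K] (t : Fin 2 → K)
    (y : QVar I (fun i => v₁ i + v₂ i) (fun j => w₁ j + w₂ j) → K) (c : QVar I v w → K)
    (σ : ShufflePair v₁ v₂ w₁ w₂) :
    facVal hout hinc mh mhs t y c =
      facVal hout hinc mh mhs t (y ∘ inclP σ) c * facVal hout hinc mh mhs t (y ∘ inclPP σ) c := by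
  simp only [facVal, prod_lamP_mul_prod_lamPP σ, prod_zP_mul_prod_zPP σ, prod_mul_distrib]
  simp only [Function.comp_apply, inclP, inclPP, renameColors, lamVar, zVar]
  ring

lemma facVal_split_right {K : Type} [Field K] (t : Fin 2 → K)
    (y : QVar I (fun i => v₁ i + v₂ i) (fun j => w₁ j + w₂ j) → K) (c : QVar I v w → K)
    (σ : ShufflePair v₁ v₂ w₁ w₂) :
    facVal hout hinc mh mhs t c y =
      facVal hout hinc mh mhs t c (y ∘ inclP σ) * facVal hout hinc mh mhs t c (y ∘ inclPP σ) := by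
  simp only [facVal, prod_lamP_mul_prod_lamPP σ, prod_zP_mul_prod_zPP σ, prod_mul_distrib]
  simp only [Function.comp_apply, inclP, inclPP, renameColors, lamVar, zVar]
  ring

/-- The summand `f ⋅ g ⋅ fac` of the shuffle product, with the variables of the product
placed at `x` and distributed by `σ`. -/
def shuffleTerm (f : MvPolynomial (QVar I v₁ w₁) ℂ) (g : MvPolynomial (QVar I v₂ w₂) ℂ)
    (x : QVar I (fun i => v₁ i + v₂ i) (fun j => w₁ j + w₂ j) → L)
    (σ : ShufflePair v₁ v₂ w₁ w₂) : L :=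
  aeval (x ∘ inclP σ) f * aeval (x ∘ inclPP σ) g *
    facVal hout hinc mh mhs (x ∘ Sum.inl) (x ∘ inclP σ) (x ∘ inclPP σ)

lemma map_shuffleTerm (φ : L →ₐ[ℂ] L')
    (f : MvPolynomial (QVar I v₁ w₁) ℂ) (g : MvPolynomial (QVar I v₂ w₂) ℂ)
    (x : QVar I (fun i => v₁ i + v₂ i) (fun j => w₁ j + w₂ j) → L)
    (σ : ShufflePair v₁ v₂ w₁ w₂) :
    φ (shuffleTerm hout hinc mh mhs f g x σ) = shuffleTerm hout hinc mh mhs f g (φ ∘ x) σ := by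
  have h {τ : Type} (y : τ → L) (p : MvPolynomial τ ℂ) : φ (aeval y p) = aeval (φ ∘ y) p :=
    DFunLike.congr_fun (comp_aeval y φ) p
  simp only [shuffleTerm, map_mul, map_facVal, h, Function.comp_assoc]

lemma shuffleTerm_mul_colorBlock {f : MvPolynomial (QVar I v₁ w₁) ℂ}
    {g : MvPolynomial (QVar I v₂ w₂) ℂ} (hf : IsSym v₁ w₁ f) (hg : IsSym v₂ w₂ g)
    (x : QVar I (fun i => v₁ i + v₂ i) (fun j => w₁ j + w₂ j) → L)
    (σ : ShufflePair v₁ v₂ w₁ w₂) (a : ColorPerm I v₁ w₁) (b : ColorPerm I v₂ w₂) :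
    shuffleTerm hout hinc mh mhs f g x (σ * colorBlock a b) =
      shuffleTerm hout hinc mh mhs f g x σ := by
  simp only [shuffleTerm, inclP_mul_colorBlock, inclPP_mul_colorBlock, ← Function.comp_assoc,
    aeval_comp_actVar hf, aeval_comp_actVar hg, facVal_comp_actVar]

lemma shuffleTerm_comp_actVar (f : MvPolynomial (QVar I v₁ w₁) ℂ)
    (g : MvPolynomial (QVar I v₂ w₂) ℂ)
    (x : QVar I (fun i => v₁ i + v₂ i) (fun j => w₁ j + w₂ j) → L)
    (ρ σ : ShufflePair v₁ v₂ w₁ w₂) :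
    shuffleTerm hout hinc mh mhs f g (x ∘ actVar ρ) σ =
      shuffleTerm hout hinc mh mhs f g x (ρ * σ) := by
  simp only [shuffleTerm, inclP_mul, inclPP_mul, Function.comp_assoc]
  rfl

variable [DecidableEq I]

/-- The shuffle product of `f` and `g` evaluated at a point `x`. -/
def hallVal (f : MvPolynomial (QVar I v₁ w₁) ℂ) (g : MvPolynomial (QVar I v₂ w₂) ℂ)
    (x : QVar I (fun i => v₁ i + v₂ i) (fun j => w₁ j + w₂ j) → L) : L :=
  ∑ σ ∈ univ.filter (fun σ : ShufflePair v₁ v₂ w₁ w₂ => IsShufflePair σ),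
    shuffleTerm hout hinc mh mhs f g x σ

lemma map_hallVal (φ : L →ₐ[ℂ] L')
    (f : MvPolynomial (QVar I v₁ w₁) ℂ) (g : MvPolynomial (QVar I v₂ w₂) ℂ)
    (x : QVar I (fun i => v₁ i + v₂ i) (fun j => w₁ j + w₂ j) → L) :
    φ (hallVal hout hinc mh mhs f g x) = hallVal hout hinc mh mhs f g (φ ∘ x) := by
  simp only [hallVal, map_sum, map_shuffleTerm]

lemma sum_shuffleTerm {f : MvPolynomial (QVar I v₁ w₁) ℂ}
    {g : MvPolynomial (QVar I v₂ w₂) ℂ} (hf : IsSym v₁ w₁ f) (hg : IsSym v₂ w₂ g)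
    (x : QVar I (fun i => v₁ i + v₂ i) (fun j => w₁ j + w₂ j) → L) :
    ∑ σ, shuffleTerm hout hinc mh mhs f g x σ =
      (Fintype.card (ColorPerm I v₁ w₁) : L) * Fintype.card (ColorPerm I v₂ w₂) *
        hallVal hout hinc mh mhs f g x :=
  sum_shufflePair _ (shuffleTerm_mul_colorBlock hout hinc mh mhs hf hg x)

lemma hallVal_comp_actVar {f : MvPolynomial (QVar I v₁ w₁) ℂ}
    {g : MvPolynomial (QVar I v₂ w₂) ℂ} (hf : IsSym v₁ w₁ f) (hg : IsSym v₂ w₂ g)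
    (x : QVar I (fun i => v₁ i + v₂ i) (fun j => w₁ j + w₂ j) → L)
    (ρ : ShufflePair v₁ v₂ w₁ w₂) :
    hallVal hout hinc mh mhs f g (x ∘ actVar ρ) = hallVal hout hinc mh mhs f g x := by
  refine mul_left_cancel₀ (mul_ne_zero (card_cast_ne_zero L (ColorPerm I v₁ w₁))
    (card_cast_ne_zero L (ColorPerm I v₂ w₂))) ?_
  rw [← sum_shuffleTerm hout hinc mh mhs hf hg, ← sum_shuffleTerm hout hinc mh mhs hf hg]
  simp only [shuffleTerm_comp_actVar]
  exact Equiv.sum_comp (Equiv.mulLeft ρ) (shuffleTerm hout hinc mh mhs f g x)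

lemma hallSum_eq_hallVal (f : MvPolynomial (QVar I v₁ w₁) ℂ)
    (g : MvPolynomial (QVar I v₂ w₂) ℂ) :
    hallSum hout hinc mh mhs f g = hallVal hout hinc mh mhs f g (genericPt _ _) := by
  refine sum_congr rfl fun σ _ => ?_
  simp only [shuffleTerm, aeval_genericPt_comp]
  refine congrArg₂ _ rfl ?_
  simp only [facQ, facVal, map_add, map_sub, map_mul, genericPt, Function.comp_apply]
  simp only [map_intCast, inclP, inclPP, renameColors, lamVar, zVar, t1Var, t2Var]

/-- A polynomial representing the shuffle product generically represents it at every point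
with algebraically independent coordinates. -/
lemma aeval_eq_hallVal {f : MvPolynomial (QVar I v₁ w₁) ℂ}
    {g : MvPolynomial (QVar I v₂ w₂) ℂ}
    {p : MvPolynomial (QVar I (fun i => v₁ i + v₂ i) (fun j => w₁ j + w₂ j)) ℂ}
    (hp : embQ _ _ p = hallSum hout hinc mh mhs f g)
    {x : QVar I (fun i => v₁ i + v₂ i) (fun j => w₁ j + w₂ j) → L}
    (hx : Function.Injective (aeval x : MvPolynomial _ ℂ →ₐ[ℂ] L)) :
    aeval x p = hallVal hout hinc mh mhs f g x := by
  obtain ⟨φ, hφ, hφx⟩ := exists_algHom_genericPt hx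
  rw [← hφ, hp, hallSum_eq_hallVal, map_hallVal, hφx]

end Values

/-! ### Pole cancellation -/

section Divisibility

variable {τ : Type}

/-- The substitution replacing the variable `a` by `b`. -/
def collapseVar (a b : τ) : τ → τ := fun c => if c = a then b else c

lemma X_sub_X_dvd {a b : τ} {q : MvPolynomial τ ℂ}
    (h : rename (collapseVar a b) q = 0) : (X a - X b : MvPolynomial τ ℂ) ∣ q := by
  set J : Ideal (MvPolynomial τ ℂ) := Ideal.span {X a - X b}
  have hJ : (Ideal.Quotient.mkₐ ℂ J).comp (rename (collapseVar a b)) =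
      Ideal.Quotient.mkₐ ℂ J := by
    refine algHom_ext fun c => ?_
    rw [AlgHom.comp_apply, rename_X]
    by_cases hc : c = a
    · subst hc
      rw [collapseVar, if_pos rfl]
      refine (Ideal.Quotient.eq.2 ?_).symm
      exact Ideal.mem_span_singleton_self _
    · rw [collapseVar, if_neg hc]
  rw [← Ideal.mem_span_singleton, ← Ideal.Quotient.eq_zero_iff_mem]
  have := DFunLike.congr_fun hJ q
  rw [AlgHom.comp_apply, h, map_zero] at this
  exact this.symm

lemma prod_X_sub_X_dvd {ι : Type} (S : Finset ι) (a b : ι → τ) (hne : ∀ k ∈ S, a k ≠ b k)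
    (hinj : Set.InjOn (fun k => s(a k, b k)) S) (q : MvPolynomial τ ℂ)
    (hq : ∀ k ∈ S, rename (collapseVar (a k) (b k)) q = 0) :
    ∏ k ∈ S, (X (a k) - X (b k) : MvPolynomial τ ℂ) ∣ q := by
  induction S using Finset.induction_on generalizing q with
  | empty => simp
  | insert k S hk ih =>
    obtain ⟨q', rfl⟩ := X_sub_X_dvd (hq k (mem_insert_self k S))
    rw [prod_insert hk]
    refine mul_dvd_mul_left _ (ih (fun l hl => hne l (mem_insert_of_mem hl))
      (hinj.mono (by simp)) q' fun l hl => ?_)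
    have h := hq l (mem_insert_of_mem hl)
    rw [map_mul] at h
    refine (mul_eq_zero.1 h).resolve_left fun h0 => ?_
    have hkl : s(a k, b k) ≠ s(a l, b l) := fun e =>
      hk (hinj (by simp) (by simp [hl]) e ▸ hl)
    have h1 := hne k (mem_insert_self k S)
    have h2 := hne l (mem_insert_of_mem hl)
    rw [map_sub, rename_X, rename_X, sub_eq_zero] at h0
    replace h0 := X_injective h0
    simp only [collapseVar] at h0
    simp only [ne_eq, Sym2.eq_iff] at hkl
    grind

end Divisibility

section Poles

variable {v w v₁ v₂ w₁ w₂ : I → ℕ} {H : Type}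

lemma lamVar_inj {i j : I} {s : Fin (v i)} {u : Fin (v j)} :
    (lamVar i s : QVar I v w) = lamVar j u ↔ (⟨i, s⟩ : Σ i, Fin (v i)) = ⟨j, u⟩ := by
  simp [lamVar]

lemma inclP_lamVar_ne_inclPP_lamVar (σ : ShufflePair v₁ v₂ w₁ w₂) {i j : I} (s : Fin (v₁ i))
    (u : Fin (v₂ j)) : inclP σ (lamVar i s) ≠ inclPP σ (lamVar j u) := by
  intro h
  have h' : (⟨i, lamP σ i s⟩ : Σ i, Fin ((fun i => v₁ i + v₂ i) i)) = ⟨j, lamPP σ j u⟩ := by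
    simpa [inclP, inclPP, renameColors, lamVar] using h
  obtain ⟨rfl, h'⟩ := Sigma.mk.inj h'
  have h' := congrArg Fin.val ((σ.1 i).injective (eq_of_heq h'))
  simp at h'
  omega

/-- The transposition of two `λ`-variables of the same color. -/
def lamSwap [DecidableEq I] (w : I → ℕ) (i : I) (s u : Fin (v i)) : ColorPerm I v w :=
  (Pi.mulSingle i (Equiv.swap s u), 1)

lemma rename_collapseVar_eq_zero [DecidableEq I] {i : I} {s u : Fin (v i)} {q : MvPolynomial (QVar I v w) ℂ}
    (hq : rename (actVar (lamSwap w i s u)) q = -q) :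
    rename (collapseVar (lamVar i s) (lamVar i u)) q = 0 := by
  have hu : collapseVar (lamVar i s : QVar I v w) (lamVar i u) ∘ actVar (lamSwap w i s u) =
      collapseVar (lamVar i s) (lamVar i u) := by
    funext x
    rcases x with x | ⟨j, x⟩ | ⟨j, x⟩
    · simp [collapseVar, actVar, renameColors, lamVar]
    · by_cases hj : j = i
      · subst hj
        simp only [Function.comp_apply, actVar, renameColors, lamVar, lamSwap, Pi.mulSingle_eq_same,
          Equiv.swap_apply_def, collapseVar]
        split_ifs <;> simp_all
      · simp [collapseVar, actVar, renameColors, lamVar, lamSwap, Pi.mulSingle_eq_of_ne hj]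
    · simp [collapseVar, actVar, renameColors, lamVar, lamSwap]
  have h := congrArg (rename (collapseVar (lamVar i s : QVar I v w) (lamVar i u))) hq
  rw [rename_rename, hu, map_neg] at h
  exact self_eq_neg.1 h

variable [Fintype I]

/-- The product of the Vandermonde determinants of the `λ`-variables of each color. -/
def lamVandermonde (v w : I → ℕ) : MvPolynomial (QVar I v w) ℂ :=
  ∏ i, (Matrix.vandermonde fun s : Fin (v i) => X (lamVar i s)).det

lemma lamVandermonde_ne_zero (v w : I → ℕ) : lamVandermonde v w ≠ 0 := by
  refine prod_ne_zero_iff.2 fun i _ => Matrix.det_vandermonde_ne_zero_iff.2 fun s u h => ?_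
  simpa [lamVar] using X_injective h

lemma rename_actVar_lamVandermonde (ρ : ColorPerm I v w) :
    rename (actVar ρ) (lamVandermonde v w) =
      (∏ i, ((Perm.sign (ρ.1 i) : ℤ) : MvPolynomial (QVar I v w) ℂ)) * lamVandermonde v w := by
  rw [lamVandermonde, map_prod, ← prod_mul_distrib]
  refine prod_congr rfl fun i _ => ?_
  rw [← Matrix.det_permute, AlgHom.map_det]
  congr 1
  ext s u
  simp [Matrix.vandermonde, actVar, renameColors, lamVar]

variable [Fintype H] (hout hinc : H → I) (mh mhs : H → ℤ)

lemma facVal_mul_mem {L : Type} [Field L] (S : Subring L) {t : Fin 2 → L}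
    {a : QVar I v₁ w₁ → L} {b : QVar I v₂ w₂ → L} (ht : ∀ k, t k ∈ S) (ha : ∀ k, a k ∈ S)
    (hb : ∀ k, b k ∈ S) (hab : ∀ i s u, b (lamVar i u) - a (lamVar i s) ≠ 0) {c : L} (hc : c ∈ S) :
    facVal hout hinc mh mhs t a b *
      ((∏ i, ∏ s : Fin (v₁ i), ∏ u : Fin (v₂ i), (b (lamVar i u) - a (lamVar i s))) * c) ∈ S := by
  have hd : (∏ i, ∏ s : Fin (v₁ i), ∏ u : Fin (v₂ i), (b (lamVar i u) - a (lamVar i s))) ≠ 0 :=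
    prod_ne_zero_iff.2 fun i _ => prod_ne_zero_iff.2 fun s _ => prod_ne_zero_iff.2 fun u _ =>
      hab i s u
  simp only [facVal, prod_div_distrib]
  rw [mul_right_comm, ← mul_assoc (_ / _), div_mul_cancel₀ _ hd]
  have hm (n : ℤ) : (n : L) ∈ S := intCast_mem S n
  refine S.mul_mem (S.mul_mem ?_ hc) (S.mul_mem (S.prod_mem fun h _ => S.mul_mem ?_ ?_)
    (S.prod_mem fun i _ => S.mul_mem ?_ ?_))
  · exact S.prod_mem fun i _ => S.prod_mem fun s _ => S.prod_mem fun u _ =>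
      S.add_mem (S.add_mem (S.sub_mem (ha _) (hb _)) (ht _)) (ht _)
  · exact S.prod_mem fun s _ => S.prod_mem fun u _ =>
      S.add_mem (S.sub_mem (hb _) (ha _)) (S.mul_mem (hm _) (ht _))
  · exact S.prod_mem fun s _ => S.prod_mem fun u _ =>
      S.add_mem (S.sub_mem (hb _) (ha _)) (S.mul_mem (hm _) (ht _))
  · exact S.prod_mem fun s _ => S.prod_mem fun u _ => S.add_mem (S.sub_mem (hb _) (ha _)) (ht _)
  · exact S.prod_mem fun s _ => S.prod_mem fun u _ => S.add_mem (S.sub_mem (hb _) (ha _)) (ht _)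

variable [DecidableEq I]

lemma rename_lamSwap_lamVandermonde {i : I} {s u : Fin (v i)} (h : s ≠ u) :
    rename (actVar (lamSwap w i s u)) (lamVandermonde v w) = -lamVandermonde v w := by
  rw [rename_actVar_lamVandermonde, prod_eq_single i]
  · simp [lamSwap, Perm.sign_swap h]
  · intro j _ hj
    simp [lamSwap, Pi.mulSingle_eq_of_ne hj]
  · simp

lemma lamVandermonde_dvd {q : MvPolynomial (QVar I v w) ℂ}
    (hq : ∀ (i : I) (s u : Fin (v i)), s ≠ u → rename (actVar (lamSwap w i s u)) q = -q) :
    lamVandermonde v w ∣ q := by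
  simp only [lamVandermonde, Matrix.det_vandermonde, prod_sigma']
  refine prod_X_sub_X_dvd _ (fun k : Σ i, Σ _ : Fin (v i), Fin (v i) => lamVar k.1 k.2.2)
    (fun k => lamVar k.1 k.2.1) ?_ ?_ q ?_
  · rintro ⟨i, s, u⟩ h
    simp only [mem_sigma, mem_univ, mem_Ioi, true_and] at h
    simpa [lamVar_inj] using h.ne'
  · rintro ⟨i, s, u⟩ h ⟨j, s', u'⟩ h' e
    simp only [coe_sigma, Set.mem_sigma_iff, mem_coe, mem_Ioi, true_and, coe_univ,
      Set.mem_univ] at h h'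
    simp only [Sym2.eq_iff, lamVar_inj, Sigma.mk.injEq] at e
    rcases e with ⟨⟨rfl, e⟩, -, e'⟩ | ⟨⟨rfl, e⟩, -, e'⟩
    · rw [eq_of_heq e, eq_of_heq e']
    · rw [eq_of_heq e, eq_of_heq e'] at h
      exact absurd h h'.asymm
  · rintro ⟨i, s, u⟩ h
    simp only [mem_sigma, mem_univ, mem_Ioi, true_and] at h
    exact rename_collapseVar_eq_zero (hq i u s h.ne')

lemma cross_prod_dvd_lamVandermonde (σ : ShufflePair v₁ v₂ w₁ w₂) :
    (∏ i, ∏ s : Fin (v₁ i), ∏ u : Fin (v₂ i),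
      (X (inclPP σ (lamVar i u)) - X (inclP σ (lamVar i s)))) ∣
      lamVandermonde (fun i => v₁ i + v₂ i) (fun j => w₁ j + w₂ j) := by
  simp only [prod_sigma']
  refine prod_X_sub_X_dvd _
    (fun k : Σ i, Σ _ : Fin (v₁ i), Fin (v₂ i) => inclPP σ (lamVar k.1 k.2.2))
    (fun k => inclP σ (lamVar k.1 k.2.1)) ?_ ?_ _ ?_
  · rintro ⟨i, s, u⟩ -
    exact (inclP_lamVar_ne_inclPP_lamVar σ s u).symm
  · rintro ⟨i, s, u⟩ - ⟨j, s', u'⟩ - e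
    simp only [Sym2.eq_iff, (inclP_injective σ).eq_iff, (inclPP_injective σ).eq_iff, lamVar_inj,
      (inclP_lamVar_ne_inclPP_lamVar σ _ _).symm, false_and, or_false, Sigma.mk.injEq] at e
    obtain ⟨⟨rfl, e⟩, -, e'⟩ := e
    rw [eq_of_heq e, eq_of_heq e']
  · rintro ⟨i, s, u⟩ -
    refine rename_collapseVar_eq_zero (v := fun i => v₁ i + v₂ i) (i := i) (s := lamPP σ i u)
      (u := lamP σ i s) (rename_lamSwap_lamVandermonde (v := fun i => v₁ i + v₂ i) fun h => ?_)
    exact inclP_lamVar_ne_inclPP_lamVar σ s u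
      (congrArg (lamVar (v := fun i => v₁ i + v₂ i) (w := fun j => w₁ j + w₂ j) i) h.symm)

lemma shuffleTerm_mul_lamVandermonde_mem (f : MvPolynomial (QVar I v₁ w₁) ℂ)
    (g : MvPolynomial (QVar I v₂ w₂) ℂ) (σ : ShufflePair v₁ v₂ w₁ w₂) :
    shuffleTerm hout hinc mh mhs f g (genericPt _ _) σ * embQ _ _ (lamVandermonde _ _) ∈
      (embQ (fun i => v₁ i + v₂ i) (fun j => w₁ j + w₂ j)).range := by
  obtain ⟨c, hc⟩ := cross_prod_dvd_lamVandermonde σ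
  rw [shuffleTerm, mul_assoc, aeval_genericPt_comp, aeval_genericPt_comp, hc, map_mul]
  refine Subring.mul_mem _ (Subring.mul_mem _ ⟨_, rfl⟩ ⟨_, rfl⟩) ?_
  simp only [map_prod, map_sub]
  refine facVal_mul_mem hout hinc mh mhs (embQ _ _).range (fun k => ⟨_, rfl⟩) (fun k => ⟨_, rfl⟩)
    (fun k => ⟨_, rfl⟩) (fun i s u h => ?_) ⟨_, rfl⟩
  exact inclP_lamVar_ne_inclPP_lamVar σ s u
    (X_injective (embQ_injective _ _ (sub_eq_zero.1 h))).symm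

/-- The poles of the shuffle product cancel. -/
lemma exists_embQ_eq_hallSum {f : MvPolynomial (QVar I v₁ w₁) ℂ}
    {g : MvPolynomial (QVar I v₂ w₂) ℂ} (hf : IsSym v₁ w₁ f) (hg : IsSym v₂ w₂ g) :
    ∃ p, embQ _ _ p = hallSum hout hinc mh mhs f g := by
  have hmem : hallVal hout hinc mh mhs f g (genericPt _ _) * embQ _ _ (lamVandermonde _ _) ∈
      (embQ (fun i => v₁ i + v₂ i) (fun j => w₁ j + w₂ j)).range := by
    rw [hallVal, sum_mul]
    exact Subring.sum_mem _ fun σ _ => shuffleTerm_mul_lamVandermonde_mem hout hinc mh mhs f g σ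
  obtain ⟨q, hq⟩ := hmem
  obtain ⟨p, rfl⟩ : lamVandermonde _ _ ∣ q := by
    refine lamVandermonde_dvd fun i s u hsu => embQ_injective _ _ ?_
    obtain ⟨φ, hφ, hφx⟩ := exists_algHom_genericPt (aeval_genericPt_comp_injective
      (actVar_injective (lamSwap (v := fun i => v₁ i + v₂ i)
        (fun j => w₁ j + w₂ j) i s u)))
    rw [← aeval_genericPt_comp, ← hφ, hq, map_mul, map_hallVal, hφx, hφ, aeval_genericPt_comp,
      rename_lamSwap_lamVandermonde (v := fun i => v₁ i + v₂ i) hsu,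
      hallVal_comp_actVar hout hinc mh mhs hf hg, map_neg, map_neg, hq, mul_neg]
  refine ⟨p, mul_right_cancel₀ ((map_ne_zero_iff _ (embQ_injective _ _)).2
    (lamVandermonde_ne_zero _ _)) ?_⟩
  rw [hallSum_eq_hallVal, ← hq, map_mul, mul_comm]

lemma isSym_of_embQ_eq_hallSum {f : MvPolynomial (QVar I v₁ w₁) ℂ}
    {g : MvPolynomial (QVar I v₂ w₂) ℂ} (hf : IsSym v₁ w₁ f) (hg : IsSym v₂ w₂ g)
    {p : MvPolynomial (QVar I (fun i => v₁ i + v₂ i) (fun j => w₁ j + w₂ j)) ℂ}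
    (hp : embQ _ _ p = hallSum hout hinc mh mhs f g) : IsSym _ _ p := by
  intro ρ π
  refine embQ_injective _ _ ?_
  have hinj := aeval_genericPt_comp_injective (actVar_injective
    ((ρ, π) : ColorPerm I (fun i => v₁ i + v₂ i) (fun j => w₁ j + w₂ j)))
  have h := aeval_eq_hallVal hout hinc mh mhs hp hinj
  rw [aeval_genericPt_comp, hallVal_comp_actVar hout hinc mh mhs hf hg, ← hallSum_eq_hallVal,
    ← hp] at h
  exact h

end Poles

/-! ### Associativity and unit -/

section Assoc

variable {v₁ v₂ v₃ w₁ w₂ w₃ : I → ℕ} {H L : Type} [Field L] [Algebra ℂ L]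

lemma actVar_one {v w : I → ℕ} : actVar (1 : ColorPerm I v w) = id := by
  funext q
  rcases q with q | ⟨i, q⟩ | ⟨i, q⟩ <;> rfl

/-- The reassociation of the positions of the variables of a triple product. -/
def assocVar (v₁ v₂ v₃ w₁ w₂ w₃ : I → ℕ) :
    QVar I (fun i => v₁ i + (v₂ i + v₃ i)) (fun j => w₁ j + (w₂ j + w₃ j)) →
      QVar I (fun i => v₁ i + v₂ i + v₃ i) (fun j => w₁ j + w₂ j + w₃ j) :=
  renameColors (fun i => Fin.cast (Nat.add_assoc (v₁ i) (v₂ i) (v₃ i)).symm)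
    (fun j => Fin.cast (Nat.add_assoc (w₁ j) (w₂ j) (w₃ j)).symm)

lemma assocVar_injective (v₁ v₂ v₃ w₁ w₂ w₃ : I → ℕ) :
    Function.Injective (assocVar v₁ v₂ v₃ w₁ w₂ w₃) :=
  renameColors_injective (fun _ => Fin.cast_injective _) (fun _ => Fin.cast_injective _)

/-- The reassociation of colorwise permutations. -/
def assocPerm (v₁ v₂ v₃ w₁ w₂ w₃ : I → ℕ) :
    ShufflePair (fun i => v₁ i + v₂ i) v₃ (fun j => w₁ j + w₂ j) w₃ ≃
      ShufflePair v₁ (fun i => v₂ i + v₃ i) w₁ (fun j => w₂ j + w₃ j) :=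
  Equiv.prodCongr
    (Equiv.piCongrRight fun i => (finCongr (Nat.add_assoc (v₁ i) (v₂ i) (v₃ i))).permCongr)
    (Equiv.piCongrRight fun j => (finCongr (Nat.add_assoc (w₁ j) (w₂ j) (w₃ j))).permCongr)

lemma assocVar_comp_inclP
    (σ : ShufflePair (fun i => v₁ i + v₂ i) v₃ (fun j => w₁ j + w₂ j) w₃) :
    assocVar v₁ v₂ v₃ w₁ w₂ w₃ ∘ inclP (assocPerm v₁ v₂ v₃ w₁ w₂ w₃ σ) =
      inclP σ ∘ inclP (1 : ShufflePair v₁ v₂ w₁ w₂) := by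
  funext q
  rcases q with q | ⟨i, q⟩ | ⟨i, q⟩ <;> rfl

lemma assocVar_comp_inclPP_inclP
    (σ : ShufflePair (fun i => v₁ i + v₂ i) v₃ (fun j => w₁ j + w₂ j) w₃) :
    assocVar v₁ v₂ v₃ w₁ w₂ w₃ ∘ inclPP (assocPerm v₁ v₂ v₃ w₁ w₂ w₃ σ) ∘
        inclP (1 : ShufflePair v₂ v₃ w₂ w₃) =
      inclP σ ∘ inclPP (1 : ShufflePair v₁ v₂ w₁ w₂) := by
  funext q
  rcases q with q | ⟨i, q⟩ | ⟨i, q⟩ <;> rfl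

lemma assocVar_comp_inclPP_inclPP
    (σ : ShufflePair (fun i => v₁ i + v₂ i) v₃ (fun j => w₁ j + w₂ j) w₃) :
    assocVar v₁ v₂ v₃ w₁ w₂ w₃ ∘ inclPP (assocPerm v₁ v₂ v₃ w₁ w₂ w₃ σ) ∘
        inclPP (1 : ShufflePair v₂ v₃ w₂ w₃) =
      inclPP σ := by
  funext q
  rcases q with q | ⟨i, q⟩ | ⟨i, q⟩
  · rfl
  · have h : Fin.cast (Nat.add_assoc (v₁ i) (v₂ i) (v₃ i)).symm
        (Fin.natAdd (v₁ i) (Fin.natAdd (v₂ i) q)) = Fin.natAdd (v₁ i + v₂ i) q :=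
      Fin.ext (by simp [Nat.add_assoc])
    exact congrArg (fun r => (Sum.inr (Sum.inl ⟨i, σ.1 i r⟩) : QVar I
      (fun i => v₁ i + v₂ i + v₃ i) (fun j => w₁ j + w₂ j + w₃ j))) h
  · have h : Fin.cast (Nat.add_assoc (w₁ i) (w₂ i) (w₃ i)).symm
        (Fin.natAdd (w₁ i) (Fin.natAdd (w₂ i) q)) = Fin.natAdd (w₁ i + w₂ i) q :=
      Fin.ext (by simp [Nat.add_assoc])
    exact congrArg (fun r => (Sum.inr (Sum.inr ⟨i, σ.2 i r⟩) : QVar I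
      (fun i => v₁ i + v₂ i + v₃ i) (fun j => w₁ j + w₂ j + w₃ j))) h

variable [Fintype I] [Fintype H] (hout hinc : H → I) (mh mhs : H → ℤ)

/-- The summand of the triple shuffle product at points `a`, `b`, `c` for the three groups of
variables. -/
def tripleTerm (f : MvPolynomial (QVar I v₁ w₁) ℂ) (g : MvPolynomial (QVar I v₂ w₂) ℂ)
    (h : MvPolynomial (QVar I v₃ w₃) ℂ) (t : Fin 2 → L) (a : QVar I v₁ w₁ → L)
    (b : QVar I v₂ w₂ → L) (c : QVar I v₃ w₃ → L) : L :=
  aeval a f * aeval b g * aeval c h * (facVal hout hinc mh mhs t a b *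
    facVal hout hinc mh mhs t a c * facVal hout hinc mh mhs t b c)

variable [DecidableEq I] {f : MvPolynomial (QVar I v₁ w₁) ℂ}
  {g : MvPolynomial (QVar I v₂ w₂) ℂ} {h : MvPolynomial (QVar I v₃ w₃) ℂ}

lemma card_mul_hallVal_left (hf : IsSym v₁ w₁ f) (hg : IsSym v₂ w₂ g) (hh : IsSym v₃ w₃ h)
    {p : MvPolynomial (QVar I (fun i => v₁ i + v₂ i) (fun j => w₁ j + w₂ j)) ℂ}
    (hp : embQ _ _ p = hallSum hout hinc mh mhs f g)
    (x : QVar I (fun i => v₁ i + v₂ i + v₃ i) (fun j => w₁ j + w₂ j + w₃ j) → L)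
    (hx : Function.Injective (aeval x : MvPolynomial _ ℂ →ₐ[ℂ] L)) :
    (Fintype.card (ColorPerm I v₁ w₁) : L) * Fintype.card (ColorPerm I v₂ w₂) *
        Fintype.card (ColorPerm I v₃ w₃) * hallVal hout hinc mh mhs p h x =
      ∑ σ : ShufflePair (fun i => v₁ i + v₂ i) v₃ (fun j => w₁ j + w₂ j) w₃,
        tripleTerm hout hinc mh mhs f g h (x ∘ Sum.inl)
          (x ∘ inclP σ ∘ inclP (1 : ShufflePair v₁ v₂ w₁ w₂))
          (x ∘ inclP σ ∘ inclPP (1 : ShufflePair v₁ v₂ w₁ w₂)) (x ∘ inclPP σ) := by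
  set T := fun σ : ShufflePair (fun i => v₁ i + v₂ i) v₃ (fun j => w₁ j + w₂ j) w₃ =>
    tripleTerm hout hinc mh mhs f g h (x ∘ Sum.inl)
      (x ∘ inclP σ ∘ inclP (1 : ShufflePair v₁ v₂ w₁ w₂))
      (x ∘ inclP σ ∘ inclPP (1 : ShufflePair v₁ v₂ w₁ w₂)) (x ∘ inclPP σ) with hT
  have hps := isSym_of_embQ_eq_hallSum hout hinc mh mhs hf hg hp
  have hterm (σ : ShufflePair (fun i => v₁ i + v₂ i) v₃ (fun j => w₁ j + w₂ j) w₃) :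
      (Fintype.card (ColorPerm I v₁ w₁) : L) * Fintype.card (ColorPerm I v₂ w₂) *
        shuffleTerm hout hinc mh mhs p h x σ =
      ∑ τ : ShufflePair v₁ v₂ w₁ w₂, T (σ * colorBlock τ 1) := by
    have hinj : Function.Injective (aeval (x ∘ inclP σ) : MvPolynomial _ ℂ →ₐ[ℂ] L) := by
      intro q q' e
      rw [← aeval_rename, ← aeval_rename] at e
      exact rename_injective _ (inclP_injective σ) (hx e)
    rw [shuffleTerm, aeval_eq_hallVal hout hinc mh mhs hp hinj, ← mul_assoc, ← mul_assoc,
      ← sum_shuffleTerm hout hinc mh mhs hf hg, sum_mul, sum_mul]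
    refine sum_congr rfl fun τ _ => ?_
    rw [facVal_split_left hout hinc mh mhs _ _ _ τ]
    simp only [hT, tripleTerm, shuffleTerm, inclP_mul_colorBlock, inclPP_mul_colorBlock,
      actVar_one, Function.comp_id, Function.comp_assoc, ← inclP_mul, ← inclPP_mul, mul_one]
    rw [show inclP σ ∘ (Sum.inl : Fin 2 → _) = Sum.inl from rfl]
    ring
  refine mul_left_cancel₀
    (card_cast_ne_zero L (ColorPerm I (fun i => v₁ i + v₂ i) (fun j => w₁ j + w₂ j))) ?_
  have hs := sum_shuffleTerm hout hinc mh mhs hps hh x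
  calc _ = (Fintype.card (ColorPerm I v₁ w₁) : L) * Fintype.card (ColorPerm I v₂ w₂) *
        ∑ σ, shuffleTerm hout hinc mh mhs p h x σ := by rw [hs]; ring
    _ = ∑ τ : ShufflePair v₁ v₂ w₁ w₂,
        ∑ σ : ShufflePair (fun i => v₁ i + v₂ i) v₃ (fun j => w₁ j + w₂ j) w₃,
          T (σ * colorBlock τ 1) := by
      rw [mul_sum, sum_comm]
      exact sum_congr rfl fun σ _ => hterm σ
    _ = ∑ τ : ShufflePair v₁ v₂ w₁ w₂, ∑ σ, T σ :=
      sum_congr rfl fun τ _ => Equiv.sum_comp (Equiv.mulRight (colorBlock τ 1)) T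
    _ = _ := by rw [sum_const, card_univ, nsmul_eq_mul]

lemma card_mul_hallVal_right (hf : IsSym v₁ w₁ f) (hg : IsSym v₂ w₂ g) (hh : IsSym v₃ w₃ h)
    {p : MvPolynomial (QVar I (fun i => v₂ i + v₃ i) (fun j => w₂ j + w₃ j)) ℂ}
    (hp : embQ _ _ p = hallSum hout hinc mh mhs g h)
    (x : QVar I (fun i => v₁ i + (v₂ i + v₃ i)) (fun j => w₁ j + (w₂ j + w₃ j)) → L)
    (hx : Function.Injective (aeval x : MvPolynomial _ ℂ →ₐ[ℂ] L)) :
    (Fintype.card (ColorPerm I v₁ w₁) : L) * Fintype.card (ColorPerm I v₂ w₂) *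
        Fintype.card (ColorPerm I v₃ w₃) * hallVal hout hinc mh mhs f p x =
      ∑ σ : ShufflePair v₁ (fun i => v₂ i + v₃ i) w₁ (fun j => w₂ j + w₃ j),
        tripleTerm hout hinc mh mhs f g h (x ∘ Sum.inl) (x ∘ inclP σ)
          (x ∘ inclPP σ ∘ inclP (1 : ShufflePair v₂ v₃ w₂ w₃))
          (x ∘ inclPP σ ∘ inclPP (1 : ShufflePair v₂ v₃ w₂ w₃)) := by
  set T := fun σ : ShufflePair v₁ (fun i => v₂ i + v₃ i) w₁ (fun j => w₂ j + w₃ j) =>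
    tripleTerm hout hinc mh mhs f g h (x ∘ Sum.inl) (x ∘ inclP σ)
      (x ∘ inclPP σ ∘ inclP (1 : ShufflePair v₂ v₃ w₂ w₃))
      (x ∘ inclPP σ ∘ inclPP (1 : ShufflePair v₂ v₃ w₂ w₃)) with hT
  have hps := isSym_of_embQ_eq_hallSum hout hinc mh mhs hg hh hp
  have hterm (σ : ShufflePair v₁ (fun i => v₂ i + v₃ i) w₁ (fun j => w₂ j + w₃ j)) :
      (Fintype.card (ColorPerm I v₂ w₂) : L) * Fintype.card (ColorPerm I v₃ w₃) *
        shuffleTerm hout hinc mh mhs f p x σ =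
      ∑ τ : ShufflePair v₂ v₃ w₂ w₃, T (σ * colorBlock 1 τ) := by
    have hinj : Function.Injective (aeval (x ∘ inclPP σ) : MvPolynomial _ ℂ →ₐ[ℂ] L) := by
      intro q q' e
      rw [← aeval_rename, ← aeval_rename] at e
      exact rename_injective _ (inclPP_injective σ) (hx e)
    rw [shuffleTerm, aeval_eq_hallVal hout hinc mh mhs hp hinj, mul_comm (aeval _ f), ← mul_assoc,
      ← mul_assoc, ← sum_shuffleTerm hout hinc mh mhs hg hh, sum_mul, sum_mul]
    refine sum_congr rfl fun τ _ => ?_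
    rw [facVal_split_right hout hinc mh mhs _ _ _ τ]
    simp only [hT, tripleTerm, shuffleTerm, inclP_mul_colorBlock, inclPP_mul_colorBlock,
      actVar_one, Function.comp_id, Function.comp_assoc, ← inclP_mul, ← inclPP_mul, mul_one]
    rw [show inclPP σ ∘ (Sum.inl : Fin 2 → _) = Sum.inl from rfl]
    ring
  refine mul_left_cancel₀
    (card_cast_ne_zero L (ColorPerm I (fun i => v₂ i + v₃ i) (fun j => w₂ j + w₃ j))) ?_
  have hs := sum_shuffleTerm hout hinc mh mhs hf hps x
  calc _ = (Fintype.card (ColorPerm I v₂ w₂) : L) * Fintype.card (ColorPerm I v₃ w₃) *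
        ∑ σ, shuffleTerm hout hinc mh mhs f p x σ := by rw [hs]; ring
    _ = ∑ τ : ShufflePair v₂ v₃ w₂ w₃,
        ∑ σ : ShufflePair v₁ (fun i => v₂ i + v₃ i) w₁ (fun j => w₂ j + w₃ j),
          T (σ * colorBlock 1 τ) := by
      rw [mul_sum, sum_comm]
      exact sum_congr rfl fun σ _ => hterm σ
    _ = ∑ τ : ShufflePair v₂ v₃ w₂ w₃, ∑ σ, T σ :=
      sum_congr rfl fun τ _ => Equiv.sum_comp (Equiv.mulRight (colorBlock 1 τ)) T
    _ = _ := by rw [sum_const, card_univ, nsmul_eq_mul]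

lemma hallVal_assoc (hf : IsSym v₁ w₁ f) (hg : IsSym v₂ w₂ g) (hh : IsSym v₃ w₃ h)
    {p : MvPolynomial (QVar I (fun i => v₁ i + v₂ i) (fun j => w₁ j + w₂ j)) ℂ}
    (hp : embQ _ _ p = hallSum hout hinc mh mhs f g)
    {q : MvPolynomial (QVar I (fun i => v₂ i + v₃ i) (fun j => w₂ j + w₃ j)) ℂ}
    (hq : embQ _ _ q = hallSum hout hinc mh mhs g h)
    (x : QVar I (fun i => v₁ i + v₂ i + v₃ i) (fun j => w₁ j + w₂ j + w₃ j) → L)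
    (hx : Function.Injective (aeval x : MvPolynomial _ ℂ →ₐ[ℂ] L)) :
    hallVal hout hinc mh mhs p h x =
      hallVal hout hinc mh mhs f q (x ∘ assocVar v₁ v₂ v₃ w₁ w₂ w₃) := by
  have hinj : Function.Injective
      (aeval (x ∘ assocVar v₁ v₂ v₃ w₁ w₂ w₃) : MvPolynomial _ ℂ →ₐ[ℂ] L) := by
    intro q q' e
    rw [← aeval_rename, ← aeval_rename] at e
    exact rename_injective _ (assocVar_injective v₁ v₂ v₃ w₁ w₂ w₃) (hx e)
  refine mul_left_cancel₀ (mul_ne_zero (mul_ne_zero (card_cast_ne_zero L (ColorPerm I v₁ w₁))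
    (card_cast_ne_zero L (ColorPerm I v₂ w₂))) (card_cast_ne_zero L (ColorPerm I v₃ w₃))) ?_
  rw [card_mul_hallVal_left hout hinc mh mhs hf hg hh hp x hx,
    card_mul_hallVal_right hout hinc mh mhs hf hg hh hq _ hinj,
    ← Equiv.sum_comp (assocPerm v₁ v₂ v₃ w₁ w₂ w₃)]
  refine sum_congr rfl fun σ _ => ?_
  rw [Function.comp_assoc, Function.comp_assoc, Function.comp_assoc, Function.comp_assoc,
    assocVar_comp_inclP, assocVar_comp_inclPP_inclP, assocVar_comp_inclPP_inclPP]
  rfl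

end Assoc

section Unit

variable {v w : I → ℕ} {H L : Type} [Field L] [Algebra ℂ L] [Fintype I] [DecidableEq I]
  [Fintype H] (hout hinc : H → I) (mh mhs : H → ℤ)

lemma hallVal_one_left (f : MvPolynomial (QVar I v w) ℂ)
    (x : QVar I (fun i => 0 + v i) (fun j => 0 + w j) → L) :
    hallVal (v₁ := fun _ => 0) (w₁ := fun _ => 0) hout hinc mh mhs 1 f x =
      aeval (x ∘ renameColors (fun i => Fin.cast (Nat.zero_add (v i)).symm)
        (fun j => Fin.cast (Nat.zero_add (w j)).symm)) f := by
  have hr : inclPP (1 : ShufflePair (fun _ => 0) v (fun _ => 0) w) =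
      renameColors (fun i => Fin.cast (Nat.zero_add (v i)).symm)
        (fun j => Fin.cast (Nat.zero_add (w j)).symm) := by
    funext q
    rcases q with q | ⟨i, q⟩ | ⟨i, q⟩
    · rfl
    · simp [inclPP, renameColors, lamPP]
    · simp [inclPP, renameColors, zPP]
  have hone : univ.filter (fun σ : ShufflePair (fun _ : I => 0) v (fun _ => 0) w =>
      IsShufflePair σ) = {1} := by
    refine Finset.ext fun σ => ?_
    rw [mem_filter_univ, mem_singleton]
    refine ⟨fun hσ => Prod.ext (funext fun i => ?_) (funext fun i => ?_), ?_⟩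
    · exact (hσ.1 i).eq_of_range (isShuffle_one _ _) (by simp [Set.range_eq_empty])
    · exact (hσ.2 i).eq_of_range (isShuffle_one _ _) (by simp [Set.range_eq_empty])
    · rintro rfl
      exact isShufflePair_one
  rw [hallVal, hone, sum_singleton, shuffleTerm, hr]
  simp [facVal]

lemma hallVal_one_right (f : MvPolynomial (QVar I v w) ℂ)
    (x : QVar I (fun i => v i + 0) (fun j => w j + 0) → L) :
    hallVal (v₂ := fun _ => 0) (w₂ := fun _ => 0) hout hinc mh mhs f 1 x =
      aeval (x ∘ renameColors (fun i => Fin.cast (Nat.add_zero (v i)).symm)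
        (fun j => Fin.cast (Nat.add_zero (w j)).symm)) f := by
  have hr : inclP (1 : ShufflePair v (fun _ => 0) w (fun _ => 0)) =
      renameColors (fun i => Fin.cast (Nat.add_zero (v i)).symm)
        (fun j => Fin.cast (Nat.add_zero (w j)).symm) := by
    funext q
    rcases q with q | ⟨i, q⟩ | ⟨i, q⟩ <;> rfl
  have hsurj {n : ℕ} (σ : Perm (Fin (n + 0))) :
      (Set.range fun i : Fin n => σ (Fin.castAdd 0 i)) = Set.univ :=
    Set.range_eq_univ.2 σ.surjective
  have hone : univ.filter (fun σ : ShufflePair v (fun _ : I => 0) w (fun _ => 0) =>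
      IsShufflePair σ) = {1} := by
    refine Finset.ext fun σ => ?_
    rw [mem_filter_univ, mem_singleton]
    refine ⟨fun hσ => Prod.ext (funext fun i => ?_) (funext fun i => ?_), ?_⟩
    · exact (hσ.1 i).eq_of_range (isShuffle_one _ _) (by rw [hsurj, hsurj])
    · exact (hσ.2 i).eq_of_range (isShuffle_one _ _) (by rw [hsurj, hsurj])
    · rintro rfl
      exact isShufflePair_one
  rw [hallVal, hone, sum_singleton, shuffleTerm, hr]
  simp [facVal]

end Unit

section Linear

variable {v₁ v₂ w₁ w₂ : I → ℕ} {H L : Type} [Field L] [Algebra ℂ L] [Fintype I] [DecidableEq I]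
  [Fintype H] (hout hinc : H → I) (mh mhs : H → ℤ)

lemma hallVal_add_left (f f' : MvPolynomial (QVar I v₁ w₁) ℂ) (g : MvPolynomial (QVar I v₂ w₂) ℂ)
    (x : QVar I (fun i => v₁ i + v₂ i) (fun j => w₁ j + w₂ j) → L) :
    hallVal hout hinc mh mhs (f + f') g x =
      hallVal hout hinc mh mhs f g x + hallVal hout hinc mh mhs f' g x := by
  simp only [hallVal, shuffleTerm, map_add, add_mul, sum_add_distrib]

lemma hallVal_add_right (f : MvPolynomial (QVar I v₁ w₁) ℂ) (g g' : MvPolynomial (QVar I v₂ w₂) ℂ)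
    (x : QVar I (fun i => v₁ i + v₂ i) (fun j => w₁ j + w₂ j) → L) :
    hallVal hout hinc mh mhs f (g + g') x =
      hallVal hout hinc mh mhs f g x + hallVal hout hinc mh mhs f g' x := by
  simp only [hallVal, shuffleTerm, map_add, mul_add, add_mul, sum_add_distrib]

lemma hallVal_smul_left (q : MvPolynomial (Fin 2) ℂ) (f : MvPolynomial (QVar I v₁ w₁) ℂ)
    (g : MvPolynomial (QVar I v₂ w₂) ℂ)
    (x : QVar I (fun i => v₁ i + v₂ i) (fun j => w₁ j + w₂ j) → L) :
    hallVal hout hinc mh mhs (rename Sum.inl q * f) g x =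
      aeval (x ∘ Sum.inl) q * hallVal hout hinc mh mhs f g x := by
  simp only [hallVal, shuffleTerm, map_mul, mul_sum, aeval_rename]
  refine sum_congr rfl fun σ _ => ?_
  rw [Function.comp_assoc, show inclP σ ∘ (Sum.inl : Fin 2 → _) = Sum.inl from rfl]
  ring

lemma hallVal_smul_right (q : MvPolynomial (Fin 2) ℂ) (f : MvPolynomial (QVar I v₁ w₁) ℂ)
    (g : MvPolynomial (QVar I v₂ w₂) ℂ)
    (x : QVar I (fun i => v₁ i + v₂ i) (fun j => w₁ j + w₂ j) → L) :
    hallVal hout hinc mh mhs f (rename Sum.inl q * g) x =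
      aeval (x ∘ Sum.inl) q * hallVal hout hinc mh mhs f g x := by
  simp only [hallVal, shuffleTerm, map_mul, mul_sum, aeval_rename]
  refine sum_congr rfl fun σ _ => ?_
  rw [Function.comp_assoc, show inclPP σ ∘ (Sum.inl : Fin 2 → _) = Sum.inl from rfl]
  ring

end Linear

end ShuffleProduct

/-- `SH = ⊕_{v,w} SH_{v,w}` with the shuffle product is an associative, unital,
`ℕ^I × ℕ^I`-graded `ℂ[t₁,t₂]`-algebra: there is a multiplication
`SH_{v₁,w₁} → SH_{v₂,w₂} → SH_{v₁+v₂,w₁+w₂}` computed by the shuffle formula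
`Σ_σ σ(f·g·fac)` in the fraction field (pole cancellation), which is
`ℂ[t₁,t₂]`-bilinear, associative, with unit `1 ∈ SH_{0,0}`. -/
theorem framed_shuffle_algebra [Fintype I] [DecidableEq I]
    {H : Type} [Fintype H] (hout hinc : H → I) (mh mhs : H → ℤ) :
    ∃ mul : ∀ v₁ w₁ v₂ w₂ : I → ℕ, SHsym I v₁ w₁ → SHsym I v₂ w₂ →
        SHsym I (fun i => v₁ i + v₂ i) (fun j => w₁ j + w₂ j),
      -- the product is computed by the shuffle formula in the fraction field
      (∀ (v₁ w₁ v₂ w₂ : I → ℕ) (f : SHsym I v₁ w₁) (g : SHsym I v₂ w₂),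
        embQ _ _ (mul v₁ w₁ v₂ w₂ f g).val = hallSum hout hinc mh mhs f.val g.val) ∧
      -- additivity in the left argument
      (∀ (v₁ w₁ v₂ w₂ : I → ℕ) (f f' fs : SHsym I v₁ w₁) (g : SHsym I v₂ w₂),
        fs.val = f.val + f'.val →
        (mul v₁ w₁ v₂ w₂ fs g).val = (mul v₁ w₁ v₂ w₂ f g).val + (mul v₁ w₁ v₂ w₂ f' g).val) ∧
      -- additivity in the right argument
      (∀ (v₁ w₁ v₂ w₂ : I → ℕ) (f : SHsym I v₁ w₁) (g g' gs : SHsym I v₂ w₂),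
        gs.val = g.val + g'.val →
        (mul v₁ w₁ v₂ w₂ f gs).val = (mul v₁ w₁ v₂ w₂ f g).val + (mul v₁ w₁ v₂ w₂ f g').val) ∧
      -- ℂ[t₁,t₂]-linearity in the left argument (scalars act through `t₁, t₂`)
      (∀ (v₁ w₁ v₂ w₂ : I → ℕ) (q : MvPolynomial (Fin 2) ℂ)
          (f fq : SHsym I v₁ w₁) (g : SHsym I v₂ w₂),
        fq.val = rename (Sum.inl : Fin 2 → QVar I v₁ w₁) q * f.val →
        (mul v₁ w₁ v₂ w₂ fq g).val =
          rename (Sum.inl : Fin 2 → QVar I (fun i => v₁ i + v₂ i) (fun j => w₁ j + w₂ j)) q *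
            (mul v₁ w₁ v₂ w₂ f g).val) ∧
      -- ℂ[t₁,t₂]-linearity in the right argument
      (∀ (v₁ w₁ v₂ w₂ : I → ℕ) (q : MvPolynomial (Fin 2) ℂ)
          (f : SHsym I v₁ w₁) (g gq : SHsym I v₂ w₂),
        gq.val = rename (Sum.inl : Fin 2 → QVar I v₂ w₂) q * g.val →
        (mul v₁ w₁ v₂ w₂ f gq).val =
          rename (Sum.inl : Fin 2 → QVar I (fun i => v₁ i + v₂ i) (fun j => w₁ j + w₂ j)) q *
            (mul v₁ w₁ v₂ w₂ f g).val) ∧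
      -- associativity
      (∀ (v₁ w₁ v₂ w₂ v₃ w₃ : I → ℕ)
          (f : SHsym I v₁ w₁) (g : SHsym I v₂ w₂) (h : SHsym I v₃ w₃),
        (mul (fun i => v₁ i + v₂ i) (fun j => w₁ j + w₂ j) v₃ w₃
            (mul v₁ w₁ v₂ w₂ f g) h).val =
          rename (renameColors
              (fun i => Fin.cast (Nat.add_assoc (v₁ i) (v₂ i) (v₃ i)).symm)
              (fun j => Fin.cast (Nat.add_assoc (w₁ j) (w₂ j) (w₃ j)).symm))
            (mul v₁ w₁ (fun i => v₂ i + v₃ i) (fun j => w₂ j + w₃ j) f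
              (mul v₂ w₂ v₃ w₃ g h)).val) ∧
      -- the unit `1 ∈ SH_{0,0}`
      (∃ one : SHsym I (fun _ => 0) (fun _ => 0), one.val = 1 ∧
        ∀ (v w : I → ℕ) (f : SHsym I v w),
          (mul (fun _ => 0) (fun _ => 0) v w one f).val =
            rename (renameColors
                (fun i => Fin.cast (Nat.zero_add (v i)).symm)
                (fun j => Fin.cast (Nat.zero_add (w j)).symm)) f.val ∧
          (mul v w (fun _ => 0) (fun _ => 0) f one).val =
            rename (renameColors
                (fun i => Fin.cast (Nat.add_zero (v i)).symm)
                (fun j => Fin.cast (Nat.add_zero (w j)).symm)) f.val) := by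
  choose mul hmul using show ∀ (v₁ w₁ v₂ w₂ : I → ℕ) (f : SHsym I v₁ w₁) (g : SHsym I v₂ w₂),
      ∃ p : SHsym I (fun i => v₁ i + v₂ i) (fun j => w₁ j + w₂ j),
        embQ _ _ p.val = hallSum hout hinc mh mhs f.val g.val from fun v₁ w₁ v₂ w₂ f g => by
    obtain ⟨p, hp⟩ := exists_embQ_eq_hallSum hout hinc mh mhs f.2 g.2
    exact ⟨⟨p, isSym_of_embQ_eq_hallSum hout hinc mh mhs f.2 g.2 hp⟩, hp⟩
  have hval := fun (v₁ w₁ v₂ w₂ : I → ℕ) (f : SHsym I v₁ w₁) (g : SHsym I v₂ w₂) =>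
    (hmul v₁ w₁ v₂ w₂ f g).trans (hallSum_eq_hallVal hout hinc mh mhs f.1 g.1)
  refine ⟨mul, hmul, ?_, ?_, ?_, ?_, ?_, ⟨1, fun _ _ => map_one _⟩, rfl, ?_⟩
  · intro v₁ w₁ v₂ w₂ f f' fs g hs
    refine embQ_injective _ _ ?_
    rw [map_add, hval, hval, hval, hs, hallVal_add_left]
  · intro v₁ w₁ v₂ w₂ f g g' gs hs
    refine embQ_injective _ _ ?_
    rw [map_add, hval, hval, hval, hs, hallVal_add_right]
  · intro v₁ w₁ v₂ w₂ q f fq g hq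
    refine embQ_injective _ _ ?_
    rw [map_mul, hval, hval, hq, hallVal_smul_left, aeval_genericPt_comp]
  · intro v₁ w₁ v₂ w₂ q f g gq hq
    refine embQ_injective _ _ ?_
    rw [map_mul, hval, hval, hq, hallVal_smul_right, aeval_genericPt_comp]
  · intro v₁ w₁ v₂ w₂ v₃ w₃ f g h
    refine embQ_injective _ _ ?_
    have hx := aeval_genericPt_comp_injective
      (v := fun i => v₁ i + v₂ i + v₃ i) (w := fun j => w₁ j + w₂ j + w₃ j) Function.injective_id
    rw [Function.comp_id] at hx
    have ha := aeval_genericPt_comp_injective (assocVar_injective v₁ v₂ v₃ w₁ w₂ w₃)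
    refine (hval _ _ _ _ (mul v₁ w₁ v₂ w₂ f g) h).trans ?_
    refine (hallVal_assoc hout hinc mh mhs f.2 g.2 h.2 (hmul _ _ _ _ f g) (hmul _ _ _ _ g h)
      _ hx).trans ?_
    refine Eq.trans ?_ (aeval_genericPt_comp (assocVar v₁ v₂ v₃ w₁ w₂ w₃) _)
    exact (aeval_eq_hallVal hout hinc mh mhs (hmul _ _ _ _ f (mul v₂ w₂ v₃ w₃ g h)) ha).symm
  · intro v w f
    constructor
    · refine embQ_injective _ _ ((hval _ _ v w _ f).trans ?_)
      exact (hallVal_one_left hout hinc mh mhs f.1 _).trans (aeval_genericPt_comp _ _)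
    · refine embQ_injective _ _ ((hval v w _ _ f _).trans ?_)
      exact (hallVal_one_right hout hinc mh mhs f.1 _).trans (aeval_genericPt_comp _ _)
end
end

section
/- Let M be a commutative additive monoid, X a type, and n, m natural numbers. Suppose F : X^{n+m} → M satisfies F(μ∘ρ) = F(μ) for every μ ∈ X^{n+m} and every permutation ρ of {1,…,n+m} preserving each of the blocks {1,…,n} and {n+1,…,n+m} (where (μ∘ρ)_i = μ_{ρ(i)}). Define G : X^{n+m} → M by G(λ) = Σ_{τ∈Sh(n,m)} F(λ∘τ). Then G(λ∘σ) = G(λ) for every λ ∈ X^{n+m} and every permutation σ of {1,…,n+m}; that is, the shuffle sum of a block-symmetric function is fully symmetric. -/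
open scoped Classical

noncomputable section

/-- A permutation of `{1,…,n+m}` preserving each of the blocks `{1,…,n}` and
`{n+1,…,n+m}`. -/
def BlockPerm (n m : ℕ) (ρ : Equiv.Perm (Fin (n + m))) : Prop :=
  ∀ i : Fin (n + m), (i : ℕ) < n ↔ ((ρ i : Fin (n + m)) : ℕ) < n

theorem BlockPerm.mul {n m : ℕ} {ρ ρ' : Equiv.Perm (Fin (n + m))}
    (h : BlockPerm n m ρ) (h' : BlockPerm n m ρ') : BlockPerm n m (ρ * ρ') :=
  fun i => (h' i).trans (h (ρ' i))

theorem BlockPerm.inv {n m : ℕ} {ρ : Equiv.Perm (Fin (n + m))}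
    (h : BlockPerm n m ρ) : BlockPerm n m ρ⁻¹ := fun i => by
  simpa using (h (ρ⁻¹ i)).symm

/-- Composing with a block permutation does not enlarge the image of the first block. -/
theorem BlockPerm.range_castAdd_subset {n m : ℕ} {ρ : Equiv.Perm (Fin (n + m))}
    (h : BlockPerm n m ρ) (τ : Equiv.Perm (Fin (n + m))) :
    Set.range (fun i : Fin n => (τ * ρ) (Fin.castAdd m i)) ⊆
      Set.range (fun i : Fin n => τ (Fin.castAdd m i)) := by
  rintro _ ⟨i, rfl⟩
  exact ⟨⟨ρ (Fin.castAdd m i), (h _).1 i.2⟩, rfl⟩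

/-- Composing with a block permutation does not enlarge the image of the second block. -/
theorem BlockPerm.range_natAdd_subset {n m : ℕ} {ρ : Equiv.Perm (Fin (n + m))}
    (h : BlockPerm n m ρ) (τ : Equiv.Perm (Fin (n + m))) :
    Set.range (fun j : Fin m => (τ * ρ) (Fin.natAdd n j)) ⊆
      Set.range (fun j : Fin m => τ (Fin.natAdd n j)) := by
  rintro _ ⟨j, rfl⟩
  have hj : n ≤ (ρ (Fin.natAdd n j) : ℕ) :=
    not_lt.1 fun hlt => by simpa using (h _).2 hlt
  refine ⟨⟨ρ (Fin.natAdd n j) - n, by omega⟩, congrArg τ (Fin.ext ?_)⟩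
  simp only [Fin.val_natAdd]
  omega

/-- A coset of the block permutations contains at most one shuffle. -/
theorem IsShuffle.mul_blockPerm_eq {n m : ℕ} {τ ρ : Equiv.Perm (Fin (n + m))}
    (hτ : IsShuffle n m τ) (hρ : BlockPerm n m ρ) (hτρ : IsShuffle n m (τ * ρ)) :
    τ * ρ = τ := by
  have h₁ := (hτρ.1.range_inj hτ.1).1 <| (hρ.range_castAdd_subset τ).antisymm <| by
    simpa using hρ.inv.range_castAdd_subset (τ * ρ)
  have h₂ := (hτρ.2.range_inj hτ.2).1 <| (hρ.range_natAdd_subset τ).antisymm <| by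
    simpa using hρ.inv.range_natAdd_subset (τ * ρ)
  ext1 i
  induction i using Fin.addCases with
  | left i => exact congrFun h₁ i
  | right j => exact congrFun h₂ j

/-- Every coset of the block permutations contains a shuffle. -/
theorem exists_blockPerm_isShuffle_mul {n m : ℕ} (π : Equiv.Perm (Fin (n + m))) :
    ∃ ρ, BlockPerm n m ρ ∧ IsShuffle n m (π * ρ) := by
  set f : Fin n → Fin (n + m) := fun i => π (Fin.castAdd m i) with hf
  set g : Fin m → Fin (n + m) := fun j => π (Fin.natAdd n j) with hg
  have hfi : Function.Injective f := π.injective.comp (Fin.castAdd_injective n m)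
  have hgi : Function.Injective g := π.injective.comp (Fin.natAdd_injective m n)
  refine ⟨finSumFinEquiv.permCongr (Equiv.sumCongr (Tuple.sort f) (Tuple.sort g)), ?_, ?_, ?_⟩
  · intro i
    induction i using Fin.addCases <;> simp [Equiv.permCongr_apply]
  · have := (Tuple.monotone_sort f).strictMono_of_injective
      (hfi.comp (Tuple.sort f).injective)
    simpa [Equiv.permCongr_apply, hf, Function.comp_def] using this
  · have := (Tuple.monotone_sort g).strictMono_of_injective
      (hgi.comp (Tuple.sort g).injective)
    simpa [Equiv.permCongr_apply, hg, Function.comp_def] using this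

/-- The shuffle sum of a block-symmetric function is fully symmetric. -/
theorem shuffleSum_symmetric {M X : Type*} [AddCommMonoid M] (n m : ℕ)
    (F : (Fin (n + m) → X) → M)
    (hF : ∀ (μ : Fin (n + m) → X) (ρ : Equiv.Perm (Fin (n + m))),
      BlockPerm n m ρ → F (fun i => μ (ρ i)) = F μ) :
    ∀ (lam : Fin (n + m) → X) (σ : Equiv.Perm (Fin (n + m))),
      (∑ τ ∈ Finset.univ.filter (fun τ : Equiv.Perm (Fin (n + m)) => IsShuffle n m τ),
        F (fun i => (fun j => lam (σ j)) (τ i))) =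
      ∑ τ ∈ Finset.univ.filter (fun τ : Equiv.Perm (Fin (n + m)) => IsShuffle n m τ),
        F (fun i => lam (τ i)) := by
  intro lam σ
  choose r hr hs using exists_blockPerm_isShuffle_mul (n := n) (m := m)
  refine Finset.sum_bij (fun τ _ => σ * τ * r (σ * τ)) ?_ ?_ ?_ ?_
  · intro τ _
    simpa using hs (σ * τ)
  · intro τ₁ h₁ τ₂ h₂ h
    simp only [Finset.mem_filter, Finset.mem_univ, true_and] at h₁ h₂
    have key : τ₂ * (r (σ * τ₂) * (r (σ * τ₁))⁻¹) = τ₁ := by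
      rw [← mul_assoc, mul_inv_eq_iff_eq_mul]
      simpa [mul_assoc] using h.symm
    have := h₂.mul_blockPerm_eq ((hr _).mul (hr (σ * τ₁)).inv) (by rwa [key])
    exact key.symm.trans this
  · intro τ h
    simp only [Finset.mem_filter, Finset.mem_univ, true_and] at h
    refine ⟨σ⁻¹ * τ * r (σ⁻¹ * τ), by simpa using hs (σ⁻¹ * τ), ?_⟩
    have hσ : σ * (σ⁻¹ * τ * r (σ⁻¹ * τ)) = τ * r (σ⁻¹ * τ) := by group
    have hsh := hs (τ * r (σ⁻¹ * τ))
    rw [mul_assoc] at hsh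
    simp only [hσ]
    rw [mul_assoc]
    exact h.mul_blockPerm_eq ((hr _).mul (hr _)) hsh
  · intro τ _
    exact (hF (fun i => lam (σ (τ i))) _ (hr (σ * τ))).symm
end
end
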